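/- arXiv:1805.04315 — 6 statements merged into one kernel-verified Lean document; each statement's English description precedes it below -/
import Mathlib

section
/- Let F : A → B be a full, faithful, and exact functor between abelian categories that lifts subobjects. Then for every object H of A, H is monoform in A if and only if FH is monoform in B. -/
/-!
Basic notions from Kanda's theory of atoms in abelian categories.
-/

open CategoryTheory CategoryTheory.Limits

namespace AtomSpectrum

variable {C : Type*} [Category C] [Abelian C]

/-- An object `H` of an abelian category is *monoform* if `H ≠ 0` and for every non-zero
subobject `N ↣ H` there is no common non-zero subobject of `H` and `H/N`; that is, whenever
there are monomorphisms `H ↢ X ↣ H/N`, then `X = 0`. -/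
def Monoform (H : C) : Prop :=
  ¬ IsZero H ∧
    ∀ (N : Subobject H), ¬ IsZero (N : C) →
      ∀ (X : C) (f : X ⟶ H) (g : X ⟶ cokernel N.arrow), Mono f → Mono g → IsZero X

/-- Two objects are *atom equivalent* if they have a common non-zero subobject. -/
def AtomEquiv (H H' : C) : Prop :=
  ∃ (M : C) (f : M ⟶ H) (g : M ⟶ H'), Mono f ∧ Mono g ∧ ¬ IsZero M

variable (C) in
/-- The *atom spectrum* of an abelian category: atom-equivalence classes of monoform objects. -/
def ASpec : Type _ :=
  Quot (fun H H' : {H : C // Monoform H} => AtomEquiv H.1 H'.1)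

/-- The atom `⟨H⟩` determined by a monoform object `H`. -/
def atom (H : C) (h : Monoform H) : ASpec C := Quot.mk _ ⟨H, h⟩

/-- The *atom support* of an object `M`: all atoms `⟨H⟩` where `H` is a monoform subquotient
`L/L'` of `M` (for subobjects `L' ⊆ L ⊆ M`). -/
def ASupp (M : C) : Set (ASpec C) :=
  {α | ∃ (H : C) (h : Monoform H), atom H h = α ∧
    ∃ (L : Subobject M) (L' : Subobject (L : C)), Nonempty (H ≅ cokernel L'.arrow)}

/-- The localization topology on the atom spectrum: a set `Φ` is open iff for every
`⟨H⟩ ∈ Φ` there is some `H'` atom equivalent to `H` with `ASupp H' ⊆ Φ`. -/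
instance : TopologicalSpace (ASpec C) :=
  TopologicalSpace.generateFrom
    {Φ | ∀ (H : C) (h : Monoform H), atom H h ∈ Φ →
      ∃ (H' : C) (_ : Monoform H'), AtomEquiv H' H ∧ ASupp H' ⊆ Φ}

end AtomSpectrum

namespace CategoryTheory.Functor

open CategoryTheory

variable {A : Type*} {B : Type*} [Category A] [Category B]

/-- A functor `F : A ⥤ B` *lifts subobjects* if every monomorphism `ι : Y ↣ F.obj X` is,
up to isomorphism, of the form `F.map ι'` for a monomorphism `ι' : X' ↣ X`. -/
def LiftsSubobjects (F : A ⥤ B) : Prop :=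
  ∀ (X : A) (Y : B) (ι : Y ⟶ F.obj X), Mono ι →
    ∃ (X' : A) (ι' : X' ⟶ X), Mono ι' ∧ ∃ e : Y ≅ F.obj X', e.hom ≫ F.map ι' = ι

/-- An additive functor between abelian categories is *exact* if it preserves finite limits
and finite colimits. -/
def IsExact (F : A ⥤ B) : Prop :=
  Nonempty (Limits.PreservesFiniteLimits F) ∧ Nonempty (Limits.PreservesFiniteColimits F)

end CategoryTheory.Functor

open CategoryTheory CategoryTheory.Limits AtomSpectrum

namespace AtomSpectrum

/-- Monoformness tested on arbitrary monomorphisms instead of `Subobject`s. -/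
theorem Monoform.isZero_of_mono {C : Type*} [Category C] [Abelian C] {H : C} (hH : Monoform H)
    {N X : C} (i : N ⟶ H) [Mono i] (hN : ¬ IsZero N) (f : X ⟶ H) [Mono f]
    (g : X ⟶ cokernel i) [Mono g] : IsZero X := by
  let e : cokernel i ≅ cokernel (Subobject.mk i).arrow :=
    cokernel.mapIso _ _ (Subobject.underlyingIso i).symm (Iso.refl H) (by simp)
  exact hH.2 (Subobject.mk i) (fun h => hN (h.of_iso (Subobject.underlyingIso i).symm)) X f
    (g ≫ e.hom) inferInstance inferInstance

end AtomSpectrum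

theorem monoform_iff_of_fully_faithful_exact_liftsSubobjects
    {A B : Type*} [Category A] [Category B] [Abelian A] [Abelian B]
    (F : A ⥤ B) [F.Full] [F.Faithful] (hex : F.IsExact) (hlift : F.LiftsSubobjects)
    (H : A) :
    Monoform H ↔ Monoform (F.obj H) := by
  obtain ⟨⟨_⟩, ⟨_⟩⟩ := hex
  have hzero (X : A) : IsZero (F.obj X) ↔ IsZero X := by
    refine ⟨fun h => ?_, fun h => F.map_isZero h⟩
    rw [IsZero.iff_id_eq_zero] at h ⊢
    exact F.map_injective (by simpa using h)
  constructor
  · refine fun hH => ⟨fun h => hH.1 ((hzero H).1 h), fun N hN X f g _ _ => ?_⟩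
    obtain ⟨N', i, _, a, ha⟩ := hlift H _ N.arrow inferInstance
    obtain ⟨X', f', _, b, -⟩ := hlift H X f inferInstance
    let e : cokernel N.arrow ≅ F.obj (cokernel i) :=
      cokernel.mapIso _ (F.map i) a (Iso.refl _) (by simp [ha]) ≪≫ (PreservesCokernel.iso F i).symm
    have : Mono (F.map (F.preimage (b.inv ≫ g ≫ e.hom))) := by
      rw [F.map_preimage]
      infer_instance
    have : Mono (F.preimage (b.inv ≫ g ≫ e.hom)) := F.mono_of_mono_map this
    have hX' : IsZero X' := hH.isZero_of_mono i
      (fun h => hN (((hzero N').2 h).of_iso a)) f' (F.preimage (b.inv ≫ g ≫ e.hom))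
    exact ((hzero X').2 hX').of_iso b
  · refine fun hH => ⟨fun h => hH.1 ((hzero H).2 h), fun N hN X f g _ _ => ?_⟩
    exact (hzero X).1 (hH.isZero_of_mono (F.map N.arrow) (fun h => hN ((hzero _).1 h))
      (F.map f) (F.map g ≫ (PreservesCokernel.iso F N.arrow).hom))
end

section
/- Let F : A → B be a full, faithful, and exact functor between abelian categories that lifts subobjects, and let ASpec F : ASpec A → ASpec B be the induced map ⟨H⟩ ↦ ⟨FH⟩. Then for every object M of A one has the equality of subsets of ASpec B: (ASpec F)(ASupp M) = ASupp(FM). -/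
/-!
Basic notions from Kanda's theory of atoms in abelian categories.
-/

open CategoryTheory CategoryTheory.Limits

open CategoryTheory CategoryTheory.Limits AtomSpectrum

namespace AtomSpectrum

section

variable {C : Type*} [Category C] [Abelian C]

theorem atom_eq_of_iso {H H' : C} (e : H ≅ H') (h : Monoform H) (h' : Monoform H') :
    atom H h = atom H' h' :=
  Quot.sound ⟨H, 𝟙 H, e.hom, inferInstance, inferInstance, h.1⟩

/-- The defining condition of a monoform object may be tested on arbitrary monomorphisms. -/
theorem Monoform.isZero {H : C} (h : Monoform H) {N X : C} (n : N ⟶ H) [Mono n]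
    (hN : ¬ IsZero N) (f : X ⟶ H) (g : X ⟶ cokernel n) [Mono f] [Mono g] : IsZero X := by
  have w : n ≫ 𝟙 H = (Subobject.underlyingIso n).symm.hom ≫ (Subobject.mk n).arrow := by simp
  let e : cokernel n ≅ cokernel (Subobject.mk n).arrow :=
    cokernel.mapIso n (Subobject.mk n).arrow (Subobject.underlyingIso n).symm (Iso.refl H) w
  exact h.2 (Subobject.mk n) (fun hz => hN (hz.of_iso (Subobject.underlyingIso n).symm)) X f
    (g ≫ e.hom) inferInstance inferInstance

theorem Monoform.of_iso {H H' : C} (h : Monoform H) (e : H ≅ H') : Monoform H' := by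
  refine ⟨fun hz => h.1 (hz.of_iso e), fun N hN X f g _ _ => ?_⟩
  let c : cokernel N.arrow ≅ cokernel (N.arrow ≫ e.inv) :=
    cokernel.mapIso _ _ (Iso.refl _) e.symm (by simp)
  exact h.isZero (N.arrow ≫ e.inv) hN (f ≫ e.inv) (g ≫ c.hom)

/-- A subquotient of `M` is a quotient of an object admitting a monomorphism to `M`. -/
theorem mem_ASupp_iff {M : C} {α : ASpec C} :
    α ∈ ASupp M ↔ ∃ (H : C) (h : Monoform H), atom H h = α ∧
      ∃ (X : C) (i : X ⟶ M) (p : X ⟶ H), Mono i ∧ Epi p := by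
  constructor
  · rintro ⟨H, h, hα, L, L', ⟨e⟩⟩
    exact ⟨H, h, hα, L, L.arrow, cokernel.π L'.arrow ≫ e.inv, inferInstance, inferInstance⟩
  · rintro ⟨H, h, hα, X, i, p, _, _⟩
    let q : (Subobject.mk i : C) ⟶ H := (Subobject.underlyingIso i).hom ≫ p
    have w : (Subobject.underlyingIso (kernel.ι q)).hom ≫ kernel.ι q =
        (Subobject.mk (kernel.ι q)).arrow ≫ 𝟙 _ := by simp
    let c : cokernel (Subobject.mk (kernel.ι q)).arrow ≅ cokernel (kernel.ι q) :=
      cokernel.mapIso _ _ (Subobject.underlyingIso (kernel.ι q)) (Iso.refl _) w.symm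
    let d : cokernel (kernel.ι q) ≅ H :=
      (colimit.isColimit _).coconePointUniqueUpToIso (Abelian.epiIsCokernelOfKernel _
        (limit.isLimit _))
    exact ⟨H, h, hα, Subobject.mk i, Subobject.mk (kernel.ι q), ⟨d.symm ≪≫ c.symm⟩⟩

end

variable {A B : Type*} [Category A] [Category B] [Abelian A] [Abelian B] (F : A ⥤ B)

theorem Monoform.of_map [F.Faithful] [PreservesFiniteLimits F] [PreservesFiniteColimits F]
    {H : A} (h : Monoform (F.obj H)) : Monoform H := by
  have reflects {X : A} (hX : IsZero (F.obj X)) : IsZero X := by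
    rw [IsZero.iff_id_eq_zero]
    exact F.map_injective (hX.eq_of_src _ _)
  refine ⟨fun hz => h.1 (F.map_isZero hz), fun N hN X f g _ _ => reflects ?_⟩
  exact h.isZero (F.map N.arrow) (fun hz => hN (reflects hz)) (F.map f)
    (F.map g ≫ (PreservesCokernel.iso F N.arrow).hom)

/-- If `F` is right exact and lifts subobjects, every quotient of an object in the image of `F`
is the image of a quotient. -/
theorem exists_epi_of_liftsSubobjects [PreservesFiniteColimits F]
    (hlift : F.LiftsSubobjects) {X : A} {H : B} (p : F.obj X ⟶ H) [Epi p] :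
    ∃ (Q : A) (q : X ⟶ Q), Epi q ∧ Nonempty (H ≅ F.obj Q) := by
  obtain ⟨K, k, _, e, he⟩ := hlift X (kernel p) (kernel.ι p) inferInstance
  let d : cokernel (kernel.ι p) ≅ H :=
    (colimit.isColimit _).coconePointUniqueUpToIso (Abelian.epiIsCokernelOfKernel _
      (limit.isLimit _))
  let c : cokernel (kernel.ι p) ≅ cokernel (F.map k) :=
    cokernel.mapIso _ _ e (Iso.refl _) (by simp [he])
  exact ⟨cokernel k, cokernel.π k, inferInstance,
    ⟨d.symm ≪≫ c ≪≫ (PreservesCokernel.iso F k).symm⟩⟩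

end AtomSpectrum

/-- Let `F : A ⥤ B` be a full, faithful and exact functor between abelian
categories that lifts subobjects, and let `f = ASpec F : ASpec A → ASpec B` be the induced
map `⟨H⟩ ↦ ⟨F.obj H⟩`.  Then for every object `M` of `A` one has
`(ASpec F) '' (ASupp M) = ASupp (F.obj M)`. -/
theorem aspecMap_image_atomSupport
    {A B : Type*} [Category A] [Category B] [Abelian A] [Abelian B]
    (F : A ⥤ B) [F.Full] [F.Faithful] (hex : F.IsExact) (hlift : F.LiftsSubobjects)
    (f : ASpec A → ASpec B)
    (hf : ∀ (H : A) (h : Monoform H),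
      ∃ h' : Monoform (F.obj H), f (atom H h) = atom (F.obj H) h') :
    ∀ M : A, f '' ASupp M = ASupp (F.obj M) := by
  obtain ⟨⟨_⟩, ⟨_⟩⟩ := hex
  intro M
  ext β
  constructor
  · rintro ⟨α, hα, rfl⟩
    obtain ⟨H, h, rfl, X, i, p, _, _⟩ := mem_ASupp_iff.1 hα
    obtain ⟨h', hh'⟩ := hf H h
    exact mem_ASupp_iff.2 ⟨F.obj H, h', hh'.symm, F.obj X, F.map i, F.map p,
      inferInstance, inferInstance⟩
  · intro hβ
    obtain ⟨H, h, rfl, X, i, p, _, _⟩ := mem_ASupp_iff.1 hβ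
    obtain ⟨Y, j, _, e, -⟩ := hlift M X i inferInstance
    obtain ⟨Q, q, _, ⟨d⟩⟩ := exists_epi_of_liftsSubobjects F hlift (e.inv ≫ p)
    have hQ : Monoform Q := (h.of_iso d).of_map F
    obtain ⟨h', hh'⟩ := hf Q hQ
    exact ⟨atom Q hQ, mem_ASupp_iff.2 ⟨Q, hQ, rfl, Y, j, q, inferInstance, inferInstance⟩,
      hh'.trans (atom_eq_of_iso d h h').symm⟩
end

section
/- Let F : A → B be a full, faithful, and exact functor between abelian categories that lifts subobjects, and suppose F has a right adjoint G : B → A. Then for every object B of B, the counit ε_B : FGB → B of the adjunction is a monomorphism. -/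
/-!
Basic notions from Kanda's theory of atoms in abelian categories.
-/

open CategoryTheory CategoryTheory.Limits

open CategoryTheory CategoryTheory.Limits AtomSpectrum

/-- Let `F : A ⥤ B` be a full, faithful and exact functor between abelian
categories that lifts subobjects, and suppose `F` has a right adjoint `G`.  Then for every
object `Y` of `B` the counit `ε_Y : F (G Y) ⟶ Y` is a monomorphism. -/
theorem counit_mono_of_fully_faithful_exact_liftsSubobjects
    {A B : Type*} [Category A] [Category B] [Abelian A] [Abelian B]
    (F : A ⥤ B) [F.Full] [F.Faithful] (hex : F.IsExact) (hlift : F.LiftsSubobjects)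
    (G : B ⥤ A) (adj : F ⊣ G) :
    ∀ Y : B, Mono (adj.counit.app Y) := by
  intro Y
  have : F.IsLeftAdjoint := adj.isLeftAdjoint
  refine Preadditive.mono_of_kernel_zero ?_
  obtain ⟨X, i, _, e, he⟩ := hlift _ _ (kernel.ι (adj.counit.app Y)) inferInstance
  have hi : F.map i ≫ adj.counit.app Y = 0 := by
    rw [← cancel_epi e.hom, reassoc_of% he, kernel.condition, comp_zero]
  have hzero : i = 0 := by
    apply (adj.homEquiv X Y).symm.injective
    simp [Adjunction.homEquiv_counit, hi]
  rw [← he, hzero, F.map_zero, comp_zero]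
end

section
/- Let F_i : A_i → B (i ∈ I) be a family of full, faithful, and exact functors between abelian categories that lift subobjects, and let f : ⨆_{i∈I} ASpec A_i → ASpec B be the induced map sending ⟨H⟩ in ASpec A_i to ⟨F_i H⟩; f is continuous and open for the disjoint-union topology and the localization topologies. (a) If for all i ≠ j and all objects A_i ∈ A_i, A_j ∈ A_j the only common subobject of F_i A_i and F_j A_j is 0, then f is injective. (b) If each F_i has a right adjoint G_i such that for every B ≠ 0 in B there exists i ∈ I with G_i B ≠ 0, then f is surjective. Hence if both (a) and (b) hold, f is a homeomorphism and an order-isomorphism for the specialization orders. -/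
/-!
Basic notions from Kanda's theory of atoms in abelian categories.
-/

open CategoryTheory CategoryTheory.Limits

open CategoryTheory CategoryTheory.Limits AtomSpectrum

namespace AtomSpectrum

section Category

variable {C : Type*} [Category C]

theorem AtomEquiv.refl {H : C} (h : ¬ IsZero H) : AtomEquiv H H :=
  ⟨H, 𝟙 H, 𝟙 H, inferInstance, inferInstance, h⟩

theorem AtomEquiv.symm {H K : C} : AtomEquiv H K → AtomEquiv K H :=
  fun ⟨M, f, g, hf, hg, hM⟩ => ⟨M, g, f, hg, hf, hM⟩

theorem AtomEquiv.of_mono {M H : C} (f : M ⟶ H) [Mono f] (hM : ¬ IsZero M) : AtomEquiv M H :=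
  ⟨M, 𝟙 M, f, inferInstance, inferInstance, hM⟩

end Category

section Abelian

variable {C : Type*} [Category C] [Abelian C]

/-- An epimorphism is the cokernel of its kernel subobject. -/
noncomputable def cokernelKernelSubobjectIso {H K : C} (p : H ⟶ K) [Epi p] :
    cokernel (kernelSubobject p).arrow ≅ K :=
  cokernelIsoOfEq (kernelSubobject_arrow p).symm ≪≫ cokernelEpiComp _ _ ≪≫
    (cokernelIsCokernel _).coconePointUniqueUpToIso
      (Abelian.epiIsCokernelOfKernel _ (kernelIsKernel p))

/-- Monoform objects described through epimorphisms in place of subobjects. -/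
theorem monoform_iff {H : C} : Monoform H ↔ ¬ IsZero H ∧
    ∀ (K X : C) (p : H ⟶ K) (f : X ⟶ H) (g : X ⟶ K), Epi p → Mono f → Mono g →
      ¬ IsZero X → Mono p := by
  refine and_congr_right fun _ => ⟨fun h K X p f g _ _ _ hX => ?_, fun h N hN X f g hf hg => ?_⟩
  · by_contra hp
    refine hX (h (kernelSubobject p) (fun hz => hp ?_) X f (g ≫ (cokernelKernelSubobjectIso p).inv)
      ‹_› inferInstance)
    refine Preadditive.mono_of_isZero_kernel p (hz.of_iso (kernelSubobjectIso p).symm)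
  · by_contra hX
    have : Mono (cokernel.π N.arrow) := h _ X _ f g inferInstance hf hg hX
    refine hN ((IsZero.iff_id_eq_zero _).2 ?_)
    rw [← cancel_mono N.arrow, ← cancel_mono (cokernel.π N.arrow)]
    simp

theorem mem_aSupp_iff {M : C} {α : ASpec C} : α ∈ ASupp M ↔
    ∃ (H : C) (h : Monoform H), atom H h = α ∧
      ∃ (L : C) (i : L ⟶ M) (p : L ⟶ H), Mono i ∧ Epi p := by
  constructor
  · rintro ⟨H, h, rfl, L, L', ⟨e⟩⟩
    exact ⟨H, h, rfl, L, L.arrow, cokernel.π L'.arrow ≫ e.inv, inferInstance, inferInstance⟩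
  · rintro ⟨H, h, rfl, L, i, p, _, _⟩
    let q : (Subobject.mk i : C) ⟶ H := (Subobject.underlyingIso i).hom ≫ p
    exact ⟨H, h, rfl, Subobject.mk i, kernelSubobject q, ⟨(cokernelKernelSubobjectIso q).symm⟩⟩

theorem aSupp_mono {M N : C} (f : M ⟶ N) [Mono f] : ASupp M ⊆ ASupp N := by
  intro α hα
  obtain ⟨H, h, e, L, i, p, _, hp⟩ := mem_aSupp_iff.1 hα
  exact mem_aSupp_iff.2 ⟨H, h, e, L, i ≫ f, p, mono_comp _ _, hp⟩

theorem Monoform.of_mono {M H : C} (h : Monoform H) (i : M ⟶ H) [Mono i] (hM : ¬ IsZero M) :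
    Monoform M := by
  rw [monoform_iff] at h ⊢
  refine ⟨hM, fun K X p f g _ _ _ hX => ?_⟩
  have := h.2 (pushout i p) X (pushout.inl i p) (f ≫ i) (g ≫ pushout.inr i p) inferInstance
    inferInstance inferInstance hX
  have h2 : Mono (p ≫ pushout.inr i p) := by
    rw [← pushout.condition]; infer_instance
  exact mono_of_mono p (pushout.inr i p)

/-- Monoform objects are uniform: two non-zero subobjects meet non-trivially. -/
theorem Monoform.not_isZero_pullback {H M N : C} (h : Monoform H) (f : M ⟶ H) (g : N ⟶ H)
    [Mono f] [Mono g] (hM : ¬ IsZero M) (hN : ¬ IsZero N) : ¬ IsZero (pullback f g) := by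
  intro hP
  have hm : Mono (f ≫ cokernel.π g) := by
    refine Preadditive.mono_of_cancel_zero _ fun {T} a ha => ?_
    rw [← Category.assoc] at ha
    obtain ⟨b, hb⟩ := KernelFork.IsLimit.lift' (Abelian.monoIsKernelOfCokernel _
      (cokernelIsCokernel g)) _ ha
    have hb' : b ≫ g = a ≫ f := hb
    have hl : a = pullback.lift a b hb'.symm ≫ pullback.fst f g := (pullback.lift_fst _ _ _).symm
    rw [hl, hP.eq_of_src (pullback.fst f g) 0, comp_zero]
  have hπ : Mono (cokernel.π g) :=
    (monoform_iff.1 h).2 _ M _ f _ inferInstance inferInstance hm hM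
  refine hN ((IsZero.iff_id_eq_zero _).2 ?_)
  rw [← cancel_mono g, ← cancel_mono (cokernel.π g)]
  simp

theorem AtomEquiv.trans {H K L : C} (h : Monoform K) :
    AtomEquiv H K → AtomEquiv K L → AtomEquiv H L := by
  rintro ⟨M, f, g, _, _, hM⟩ ⟨N, f', g', _, _, hN⟩
  exact ⟨pullback g f', pullback.fst g f' ≫ f, pullback.snd g f' ≫ g', inferInstance,
    inferInstance, h.not_isZero_pullback g f' hM hN⟩

theorem atom_eq_iff {H K : C} {h : Monoform H} {k : Monoform K} :
    atom H h = atom K k ↔ AtomEquiv H K := by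
  refine ⟨fun e => ?_, fun e => Quot.sound e⟩
  have hequiv : Equivalence (fun H H' : {H : C // Monoform H} => AtomEquiv H.1 H'.1) :=
    ⟨fun H => .refl H.2.1, fun e => e.symm, fun {_ K _} e e' => e.trans K.2 e'⟩
  exact hequiv.quot_mk_eq_iff _ _ |>.1 e

theorem exists_atom (α : ASpec C) : ∃ (H : C) (h : Monoform H), atom H h = α := by
  obtain ⟨⟨H, h⟩, rfl⟩ := Quot.exists_rep α
  exact ⟨H, h, rfl⟩

end Abelian

section Functor

variable {A B : Type*} [Category A] [Category B] [Abelian A] [Abelian B] {F : A ⥤ B}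
  [PreservesFiniteLimits F]

/-- A functor lifting subobjects also lifts quotients. -/
theorem exists_lift_epi (hF : F.LiftsSubobjects) [PreservesFiniteColimits F]
    {X : A} {K : B} (p : F.obj X ⟶ K) [Epi p] :
    ∃ (K' : A) (p' : X ⟶ K') (e : K ≅ F.obj K'), Epi p' ∧ p ≫ e.hom = F.map p' := by
  obtain ⟨N, i, _, e, he⟩ := hF X (kernel p) (kernel.ι p) inferInstance
  have hp := Abelian.epiIsCokernelOfKernel _ (kernelIsKernel p)
  have hi := isColimitOfHasCokernelOfPreservesColimit F i
  have w : kernel.ι p ≫ F.map (cokernel.π i) = 0 := by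
    rw [← he, Category.assoc, ← F.map_comp, cokernel.condition, F.map_zero, comp_zero]
  have w' : F.map i ≫ p = 0 := by
    rw [← cancel_epi e.hom, ← Category.assoc, he, kernel.condition, comp_zero]
  obtain ⟨a, ha⟩ := CokernelCofork.IsColimit.desc' hp _ w
  obtain ⟨b, hb⟩ := CokernelCofork.IsColimit.desc' hi _ w'
  have ha' : p ≫ a = F.map (cokernel.π i) := ha
  have hb' : F.map (cokernel.π i) ≫ b = p := hb
  refine ⟨cokernel i, cokernel.π i, ⟨a, b, ?_, ?_⟩, inferInstance, ha'⟩
  · rw [← cancel_epi p, reassoc_of% ha', hb', Category.comp_id]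
  · rw [← cancel_epi (F.map (cokernel.π i)), reassoc_of% hb', ha', Category.comp_id]

variable [F.Faithful]

theorem isZero_map_iff (F : A ⥤ B) [PreservesFiniteLimits F] [F.Faithful] {X : A} :
    IsZero (F.obj X) ↔ IsZero X := by
  rw [IsZero.iff_id_eq_zero, IsZero.iff_id_eq_zero, ← F.map_id, F.map_eq_zero_iff]

theorem AtomEquiv.map (F : A ⥤ B) [PreservesFiniteLimits F] [F.Faithful] {H K : A} :
    AtomEquiv H K → AtomEquiv (F.obj H) (F.obj K) := by
  rintro ⟨M, f, g, _, _, hM⟩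
  exact ⟨F.obj M, F.map f, F.map g, inferInstance, inferInstance, by rwa [isZero_map_iff]⟩

theorem mono_counit (hF : F.LiftsSubobjects) {G : B ⥤ A} (adj : F ⊣ G) (Y : B) :
    Mono (adj.counit.app Y) := by
  refine Preadditive.mono_of_isZero_kernel _ ?_
  obtain ⟨K, i, _, e, he⟩ := hF _ _ (kernel.ι (adj.counit.app Y)) inferInstance
  have hi : F.map i ≫ adj.counit.app Y = F.map 0 ≫ adj.counit.app Y := by
    rw [← cancel_epi e.hom, ← Category.assoc, he, kernel.condition, F.map_zero, zero_comp,
      comp_zero]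
  have hi' : i = 0 := (adj.homEquiv K Y).symm.injective (by
    rwa [adj.homEquiv_counit, adj.homEquiv_counit])
  have hK : IsZero K := (IsZero.iff_id_eq_zero K).2 (by
    rw [← cancel_mono i, hi', comp_zero, comp_zero])
  exact ((isZero_map_iff F).2 hK).of_iso e

variable [F.Full]

/-- A non-zero common subobject of two objects in the image of `F` comes from one upstairs. -/
theorem AtomEquiv.of_map (hF : F.LiftsSubobjects) {H K : A} :
    AtomEquiv (F.obj H) (F.obj K) → AtomEquiv H K := by
  rintro ⟨M, f, g, _, _, hM⟩
  obtain ⟨M', f', hf', e, rfl⟩ := hF H M f ‹_›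
  refine ⟨M', f', F.preimage (e.inv ≫ g), hf', F.mono_of_mono_map ?_, fun hz => ?_⟩
  · rw [F.map_preimage]; infer_instance
  · exact hM (((isZero_map_iff F).2 hz).of_iso e)

variable [PreservesFiniteColimits F]

theorem monoform_map_iff (hF : F.LiftsSubobjects) {H : A} :
    Monoform (F.obj H) ↔ Monoform H := by
  rw [monoform_iff, monoform_iff, isZero_map_iff]
  refine and_congr_right fun _ => ⟨fun h K X p f g _ _ _ hX => ?_,
    fun h K X p f g _ hf hg hX => ?_⟩
  · exact F.mono_of_mono_map (h (F.obj K) (F.obj X) (F.map p) (F.map f) (F.map g) inferInstance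
      inferInstance inferInstance (by rwa [isZero_map_iff]))
  · obtain ⟨K', p', e, hp', he⟩ := exists_lift_epi hF p
    obtain ⟨X', f', hf', e', rfl⟩ := hF H X f hf
    have : Mono p' := by
      refine h K' X' p' f' (F.preimage (e'.inv ≫ g ≫ e.hom)) hp' hf' (F.mono_of_mono_map ?_)
        fun hz => hX (((isZero_map_iff F).2 hz).of_iso e')
      rw [F.map_preimage]; infer_instance
    have : Mono (p ≫ e.hom) := by rw [he]; infer_instance
    exact mono_of_mono p e.hom

theorem map_mem_aSupp_map (hF : F.LiftsSubobjects) {M H : A} {h : Monoform H}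
    (hH : atom H h ∈ ASupp M) :
    atom (F.obj H) ((monoform_map_iff hF).2 h) ∈ ASupp (F.obj M) := by
  obtain ⟨K, k, e, L, i, p, _, _⟩ := mem_aSupp_iff.1 hH
  exact mem_aSupp_iff.2 ⟨F.obj K, (monoform_map_iff hF).2 k,
    atom_eq_iff.2 ((atom_eq_iff.1 e).map F), F.obj L, F.map i, F.map p, inferInstance,
    inferInstance⟩

theorem exists_of_mem_aSupp_map (hF : F.LiftsSubobjects) {M : A} {α : ASpec B}
    (hα : α ∈ ASupp (F.obj M)) : ∃ (H : A) (h : Monoform H), atom H h ∈ ASupp M ∧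
      atom (F.obj H) ((monoform_map_iff hF).2 h) = α := by
  obtain ⟨K, k, rfl, L, i, p, _, _⟩ := mem_aSupp_iff.1 hα
  obtain ⟨L', i', hi', e, rfl⟩ := hF M L i ‹_›
  obtain ⟨K', p', e', hp', -⟩ := exists_lift_epi hF (e.inv ≫ p)
  have hK' : ¬ IsZero K' := fun hz => k.1 (((isZero_map_iff F).2 hz).of_iso e')
  have k' : Monoform (F.obj K') := k.of_mono e'.inv (by rwa [isZero_map_iff])
  exact ⟨K', (monoform_map_iff hF).1 k',
    mem_aSupp_iff.2 ⟨K', _, rfl, L', i', p', hi', hp'⟩,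
    atom_eq_iff.2 (.of_mono e'.inv k'.1)⟩

/-- The map on atom spectra induced by a functor, `⟨H⟩ ↦ ⟨F H⟩`. -/
def ASpec.map (hF : F.LiftsSubobjects) : ASpec A → ASpec B :=
  Quot.lift (fun H => atom (F.obj H.1) ((monoform_map_iff hF).2 H.2))
    fun _ _ e => atom_eq_iff.2 (e.map F)

theorem ASpec.map_atom (hF : F.LiftsSubobjects) (H : A) (h : Monoform H) :
    ASpec.map hF (atom H h) = atom (F.obj H) ((monoform_map_iff hF).2 h) := rfl

theorem ASpec.map_injective (hF : F.LiftsSubobjects) : Function.Injective (ASpec.map hF) := by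
  intro α β e
  obtain ⟨H, h, rfl⟩ := exists_atom α
  obtain ⟨K, k, rfl⟩ := exists_atom β
  exact atom_eq_iff.2 ((atom_eq_iff.1 e).of_map hF)

theorem ASpec.continuous_map (hF : F.LiftsSubobjects) : Continuous (ASpec.map hF) := by
  refine continuous_generateFrom_iff.2 fun Φ hΦ =>
    TopologicalSpace.isOpen_generateFrom_of_mem fun H h hH => ?_
  obtain ⟨H', -, ⟨M, f, g, _, _, hM⟩, hs⟩ := hΦ (F.obj H) ((monoform_map_iff hF).2 h) hH
  obtain ⟨M', g', _, e, -⟩ := hF H M g ‹_›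
  have hM' : ¬ IsZero M' := fun hz => hM (((isZero_map_iff F).2 hz).of_iso e)
  refine ⟨M', h.of_mono g' hM', .of_mono g' hM', fun α hα => ?_⟩
  obtain ⟨K, k, rfl⟩ := exists_atom α
  exact hs (aSupp_mono (e.inv ≫ f) (map_mem_aSupp_map hF hα))

theorem ASpec.isOpenMap_map (hF : F.LiftsSubobjects) : IsOpenMap (ASpec.map hF) := by
  intro U hU
  induction hU with
  | basic Φ hΦ =>
    refine TopologicalSpace.isOpen_generateFrom_of_mem ?_
    rintro H h ⟨α, hα, e⟩
    obtain ⟨K, k, rfl⟩ := exists_atom α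
    obtain ⟨K', k', e', hs⟩ := hΦ K k hα
    refine ⟨F.obj K', (monoform_map_iff hF).2 k',
      (e'.map F).trans ((monoform_map_iff hF).2 k) (atom_eq_iff.1 e), fun β hβ => ?_⟩
    obtain ⟨L, l, hL, rfl⟩ := exists_of_mem_aSupp_map hF hβ
    exact ⟨atom L l, hs hL, rfl⟩
  | univ =>
    refine TopologicalSpace.isOpen_generateFrom_of_mem ?_
    rintro H h ⟨α, -, e⟩
    obtain ⟨K, k, rfl⟩ := exists_atom α
    refine ⟨F.obj K, (monoform_map_iff hF).2 k, atom_eq_iff.1 e, fun β hβ => ?_⟩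
    obtain ⟨L, l, -, rfl⟩ := exists_of_mem_aSupp_map hF hβ
    exact ⟨atom L l, trivial, rfl⟩
  | inter s t _ _ hs ht =>
    rw [Set.image_inter (map_injective hF)]
    exact hs.inter ht
  | sUnion S _ hS =>
    rw [Set.sUnion_eq_biUnion, Set.image_iUnion₂]
    exact isOpen_biUnion hS

theorem ASpec.atom_mem_range_map (hF : F.LiftsSubobjects) {G : B ⥤ A} (adj : F ⊣ G) {Y : B}
    (h : Monoform Y) (hY : ¬ IsZero (G.obj Y)) : atom Y h ∈ Set.range (ASpec.map hF) := by
  have := mono_counit hF adj Y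
  have hz : ¬ IsZero (F.obj (G.obj Y)) := by rwa [isZero_map_iff]
  exact ⟨atom (G.obj Y) ((monoform_map_iff hF).1 (h.of_mono (adj.counit.app Y) hz)),
    atom_eq_iff.2 (.of_mono (adj.counit.app Y) hz)⟩

end Functor

end AtomSpectrum

/-- **Theorem 3.6 of the paper.** Let `F i : A i ⥤ B` (`i : I`) be a family of
full, faithful and exact functors between abelian categories that lift subobjects, and let
`f : ⨆ i, ASpec (A i) → ASpec B` be the induced map `⟨H⟩ ↦ ⟨(F i).obj H⟩`; it is continuous
and open.  (a) If for `i ≠ j` the only common subobject of `(F i).obj Aᵢ` and `(F j).obj Aⱼ`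
is `0`, then `f` is injective.  (b) If each `F i` has a right adjoint `G i` such that every
`Y ≠ 0` in `B` has `(G i).obj Y ≠ 0` for some `i`, then `f` is surjective.  If both (a) and
(b) hold, `f` is a homeomorphism and an order-isomorphism for the specialization orders. -/
theorem aspec_disjoint_union_homeomorph
    {I : Type*} {A : I → Type*} [∀ i, Category (A i)] [∀ i, Abelian (A i)]
    {B : Type*} [Category B] [Abelian B]
    (F : ∀ i, A i ⥤ B) [∀ i, (F i).Full] [∀ i, (F i).Faithful]
    (hex : ∀ i, (F i).IsExact) (hlift : ∀ i, (F i).LiftsSubobjects) :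
    ∃ f : (Σ i, ASpec (A i)) → ASpec B,
      (∀ (i : I) (H : A i) (h : Monoform H),
        ∃ h' : Monoform ((F i).obj H), f ⟨i, atom H h⟩ = atom ((F i).obj H) h') ∧
      Continuous f ∧ IsOpenMap f ∧
      ((∀ (i j : I), i ≠ j → ∀ (Ai : A i) (Aj : A j) (M : B)
          (u : M ⟶ (F i).obj Ai) (w : M ⟶ (F j).obj Aj), Mono u → Mono w → IsZero M) →
        Function.Injective f) ∧
      ((∃ G : ∀ i, B ⥤ A i, (∀ i, Nonempty (F i ⊣ G i)) ∧
          (∀ Y : B, ¬ IsZero Y → ∃ i, ¬ IsZero ((G i).obj Y))) →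
        Function.Surjective f) ∧
      (((∀ (i j : I), i ≠ j → ∀ (Ai : A i) (Aj : A j) (M : B)
          (u : M ⟶ (F i).obj Ai) (w : M ⟶ (F j).obj Aj), Mono u → Mono w → IsZero M) ∧
        (∃ G : ∀ i, B ⥤ A i, (∀ i, Nonempty (F i ⊣ G i)) ∧
          (∀ Y : B, ¬ IsZero Y → ∃ i, ¬ IsZero ((G i).obj Y)))) →
        (IsHomeomorph f ∧
          ∀ x y : Σ i, ASpec (A i), x ∈ closure {y} ↔ f x ∈ closure {f y})) := by
  have hl i : PreservesFiniteLimits (F i) := (hex i).1.some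
  have hr i : PreservesFiniteColimits (F i) := (hex i).2.some
  let f : (Σ i, ASpec (A i)) → ASpec B := fun x => ASpec.map (hlift x.1) x.2
  have hcont : Continuous f := continuous_sigma fun i => ASpec.continuous_map (hlift i)
  have hopen : IsOpenMap f := isOpenMap_sigma.2 fun i => ASpec.isOpenMap_map (hlift i)
  have hinj (ha : ∀ (i j : I), i ≠ j → ∀ (Ai : A i) (Aj : A j) (M : B)
      (u : M ⟶ (F i).obj Ai) (w : M ⟶ (F j).obj Aj), Mono u → Mono w → IsZero M) :
      Function.Injective f := by
    rintro ⟨i, α⟩ ⟨j, β⟩ e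
    obtain rfl | hij := eq_or_ne i j
    · exact congrArg (Sigma.mk i) (ASpec.map_injective (hlift i) e)
    · obtain ⟨H, h, rfl⟩ := exists_atom α
      obtain ⟨K, k, rfl⟩ := exists_atom β
      obtain ⟨M, u, w, hu, hw, hM⟩ := atom_eq_iff.1 e
      exact (hM (ha i j hij H K M u w hu hw)).elim
  have hsurj (hb : ∃ G : ∀ i, B ⥤ A i, (∀ i, Nonempty (F i ⊣ G i)) ∧
      (∀ Y : B, ¬ IsZero Y → ∃ i, ¬ IsZero ((G i).obj Y))) : Function.Surjective f := by
    obtain ⟨G, hG, hne⟩ := hb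
    intro α
    obtain ⟨Y, h, rfl⟩ := exists_atom α
    obtain ⟨i, hi⟩ := hne Y h.1
    obtain ⟨β, hβ⟩ := ASpec.atom_mem_range_map (hlift i) (hG i).some h hi
    exact ⟨⟨i, β⟩, hβ⟩
  refine ⟨f, fun i H h => ⟨_, ASpec.map_atom (hlift i) H h⟩, hcont, hopen, hinj, hsurj,
    fun ⟨ha, hb⟩ => ?_⟩
  have hf : IsHomeomorph f := ⟨hcont, hopen, hinj ha, hsurj hb⟩
  refine ⟨hf, fun x y => ?_⟩
  rw [← specializes_iff_mem_closure, ← specializes_iff_mem_closure,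
    hf.homeomorph.isInducing.specializes_iff.symm]
  rfl
end

section
/- Let A, B, C be abelian categories and let U : A → C and V : B → C be additive functors. If U is right exact and V is left exact, then the comma category (U ↓ V) is an abelian category; moreover, kernels and cokernels in (U ↓ V) are computed componentwise in A and B. -/
namespace CommaAbelian

open CategoryTheory CategoryTheory.Limits

variable {A B C : Type*} [Category A] [Category B] [Category C]
variable [Abelian A] [Abelian B] [Abelian C]
variable (U : A ⥤ C) (V : B ⥤ C) [U.Additive] [V.Additive]

/-- The componentwise zero morphism in the comma category of additive functors. -/
def zeroHom (X Y : Comma U V) : X ⟶ Y := { left := 0, right := 0, w := by simp }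

/-- Zero morphisms in the comma category `(U ↓ V)` of additive functors: componentwise. -/
instance : HasZeroMorphisms (Comma U V) where
  zero X Y := ⟨zeroHom U V X Y⟩
  comp_zero {X Y} f Z := by
    apply CommaMorphism.ext
    · show f.left ≫ 0 = 0
      simp
    · show f.right ≫ 0 = 0
      simp
  zero_comp X {Y Z} f := by
    apply CommaMorphism.ext
    · show (0 : X.left ⟶ Y.left) ≫ f.left = 0
      simp
    · show (0 : X.right ⟶ Y.right) ≫ f.right = 0
      simp

end CommaAbelian

open CategoryTheory CategoryTheory.Limits CommaAbelian

namespace CommaAbelian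

/-- A preadditive category with finite limits and colimits is abelian as soon as it admits a pair
of exact functors to abelian categories which jointly reflect isomorphisms. -/
theorem nonempty_abelian_of_jointly_reflect_isos {D A B : Type*} [Category D] [Category A]
    [Category B] [Preadditive D] [HasFiniteLimits D] [HasFiniteColimits D] [Abelian A] [Abelian B]
    (F : D ⥤ A) (G : D ⥤ B) [F.Additive] [G.Additive]
    [PreservesFiniteLimits F] [PreservesFiniteColimits F]
    [PreservesFiniteLimits G] [PreservesFiniteColimits G]
    (h : ∀ {X Y : D} (f : X ⟶ Y), IsIso (F.map f) → IsIso (G.map f) → IsIso f) :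
    Nonempty (Abelian D) := by
  have (X Y : D) (f : X ⟶ Y) : IsIso (Abelian.coimageImageComparison f) := by
    apply h
    · rw [Arrow.isIso_iff_isIso_of_isIso (Abelian.PreservesCoimageImageComparison.iso F f).hom]
      infer_instance
    · rw [Arrow.isIso_iff_isIso_of_isIso (Abelian.PreservesCoimageImageComparison.iso G f).hom]
      infer_instance
  exact ⟨Abelian.ofCoimageImageComparisonIsIso⟩

section Projections

variable {A B C : Type*} [Category A] [Category B] [Category C] (U : A ⥤ C) (V : B ⥤ C)

theorem preservesFiniteLimits_fst [HasFiniteLimits A] [HasFiniteLimits B]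
    [PreservesFiniteLimits V] : PreservesFiniteLimits (Comma.fst U V) where
  preservesFiniteLimits _ _ _ :=
    { preservesLimit := preservesLimit_of_preserves_limit_cone
        (Comma.coneOfPreservesIsLimit _ (limit.isLimit _) (limit.isLimit _)) (limit.isLimit _) }

theorem preservesFiniteLimits_snd [HasFiniteLimits A] [HasFiniteLimits B]
    [PreservesFiniteLimits V] : PreservesFiniteLimits (Comma.snd U V) where
  preservesFiniteLimits _ _ _ :=
    { preservesLimit := preservesLimit_of_preserves_limit_cone
        (Comma.coneOfPreservesIsLimit _ (limit.isLimit _) (limit.isLimit _)) (limit.isLimit _) }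

theorem preservesFiniteColimits_fst [HasFiniteColimits A] [HasFiniteColimits B]
    [PreservesFiniteColimits U] : PreservesFiniteColimits (Comma.fst U V) where
  preservesFiniteColimits _ _ _ := inferInstance

theorem preservesFiniteColimits_snd [HasFiniteColimits A] [HasFiniteColimits B]
    [PreservesFiniteColimits U] : PreservesFiniteColimits (Comma.snd U V) where
  preservesFiniteColimits _ _ _ := inferInstance

variable {U V} in
theorem isIso_of_isIso_left_of_isIso_right {X Y : Comma U V} (f : X ⟶ Y)
    (_ : IsIso f.left) (_ : IsIso f.right) : IsIso f :=
  inferInstanceAs (IsIso (Comma.isoMk (asIso f.left) (asIso f.right) f.w).hom)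

end Projections

end CommaAbelian

/-- **Proposition 5.1.** Let `A, B, C` be abelian categories and
`U : A ⥤ C`, `V : B ⥤ C` additive functors with `U` right exact and `V` left exact.  Then the
comma category `(U ↓ V)` is abelian, and kernels and cokernels in `(U ↓ V)` are computed
componentwise in `A` and `B`: every morphism `f` has a kernel (resp. cokernel) whose two
components are kernels (resp. cokernels) of the components of `f`. -/
theorem comma_abelian_of_rightExact_leftExact
    {A B C : Type*} [Category A] [Category B] [Category C]
    [Abelian A] [Abelian B] [Abelian C]
    (U : A ⥤ C) (V : B ⥤ C) [U.Additive] [V.Additive]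
    (hU : Nonempty (PreservesFiniteColimits U)) (hV : Nonempty (PreservesFiniteLimits V)) :
    Nonempty (Abelian (Comma U V)) ∧
    (∀ (X Y : Comma U V) (f : X ⟶ Y),
      (∃ (Z : Comma U V) (ι : Z ⟶ X) (w : ι ≫ f = 0)
          (h₁ : ι.left ≫ f.left = 0) (h₂ : ι.right ≫ f.right = 0),
        Nonempty (IsLimit (KernelFork.ofι ι w)) ∧
        Nonempty (IsLimit (KernelFork.ofι ι.left h₁)) ∧
        Nonempty (IsLimit (KernelFork.ofι ι.right h₂))) ∧
      (∃ (W : Comma U V) (π : Y ⟶ W) (w : f ≫ π = 0)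
          (h₁ : f.left ≫ π.left = 0) (h₂ : f.right ≫ π.right = 0),
        Nonempty (IsColimit (CokernelCofork.ofπ π w)) ∧
        Nonempty (IsColimit (CokernelCofork.ofπ π.left h₁)) ∧
        Nonempty (IsColimit (CokernelCofork.ofπ π.right h₂)))) := by
  
  obtain ⟨_⟩ := hU
  obtain ⟨_⟩ := hV
  have := preservesFiniteLimits_fst U V
  have := preservesFiniteLimits_snd U V
  have := preservesFiniteColimits_fst U V
  have := preservesFiniteColimits_snd U V
  refine ⟨nonempty_abelian_of_jointly_reflect_isos (Comma.fst U V) (Comma.snd U V)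
    isIso_of_isIso_left_of_isIso_right, ?_⟩
  have : (Comma.fst U V).PreservesZeroMorphisms := ⟨fun _ _ ↦ rfl⟩
  have : (Comma.snd U V).PreservesZeroMorphisms := ⟨fun _ _ ↦ rfl⟩
  refine fun X Y f ↦ ⟨?_, ?_⟩
  · have w := kernel.condition f
    exact ⟨kernel f, kernel.ι f, w,
      congrArg CommaMorphism.left w, congrArg CommaMorphism.right w, ⟨kernelIsKernel f⟩,
      ⟨isLimitForkMapOfIsLimit' (Comma.fst U V) w (kernelIsKernel f)⟩,
      ⟨isLimitForkMapOfIsLimit' (Comma.snd U V) w (kernelIsKernel f)⟩⟩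
  · have w := cokernel.condition f
    exact ⟨cokernel f, cokernel.π f, w,
      congrArg CommaMorphism.left w, congrArg CommaMorphism.right w, ⟨cokernelIsCokernel f⟩,
      ⟨isColimitCoforkMapOfIsColimit' (Comma.fst U V) w (cokernelIsCokernel f)⟩,
      ⟨isColimitCoforkMapOfIsColimit' (Comma.snd U V) w (cokernelIsCokernel f)⟩⟩
end

section
/- Let A, B, C be abelian categories, U : A → C right exact, and V : B → C left exact, and consider the comma category (U ↓ V) with stalk functors S_A : A → (U ↓ V) and S_B : B → (U ↓ V). (a) S_B has a right adjoint K_B : (U ↓ V) → B given by (X, Y, θ) ↦ Y. (b) If U has a right adjoint U^! with unit η, then S_A has a right adjoint K_A : (U ↓ V) → A given by (X, Y, θ) ↦ Ker(U^!θ ∘ η_X), the kernel of the composite X → U^!UX → U^!VY. In particular, if an object (X, Y, θ) satisfies K_A(X,Y,θ) = 0 and K_B(X,Y,θ) = 0, then (X, Y, θ) = 0. -/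
namespace CommaAbelian

open CategoryTheory CategoryTheory.Limits ZeroObject

variable {A B C : Type*} [Category A] [Category B] [Category C]
variable [Abelian A] [Abelian B] [Abelian C]
variable (U : A ⥤ C) (V : B ⥤ C) [U.Additive] [V.Additive]

/-- The stalk functor `S_A : A ⥤ (U ↓ V)`, `X ↦ (X, 0, 0)`. -/
noncomputable def stalkLeft : A ⥤ Comma U V where
  obj X := { left := X, right := 0, hom := 0 }
  map f := { left := f, right := 𝟙 0, w := by simp }
  map_id X := by ext <;> simp
  map_comp f g := by ext <;> simp

/-- The stalk functor `S_B : B ⥤ (U ↓ V)`, `Y ↦ (0, Y, 0)`. -/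
noncomputable def stalkRight : B ⥤ Comma U V where
  obj Y := { left := 0, right := Y, hom := 0 }
  map g := { left := 𝟙 0, right := g, w := by simp }
  map_id Y := by ext <;> simp
  map_comp f g := by ext <;> simp

end CommaAbelian

open CategoryTheory CategoryTheory.Limits CommaAbelian

namespace CommaAbelian

variable {A B C : Type*} [Category A] [Category B] [Category C]
variable [Abelian A] [Abelian B] [Abelian C]
variable {U : A ⥤ C} (V : B ⥤ C) {U' : C ⥤ A} (adj : U ⊣ U')

/-- The functor `K_A`, sending `(X, Y, θ)` to the kernel of `X ⟶ U' (U X) ⟶ U' (V Y)`. -/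
noncomputable def kernelFunctor : Comma U V ⥤ A where
  obj Z := kernel (adj.unit.app Z.left ≫ U'.map Z.hom)
  map {Z W} f := kernel.map _ _ f.left (U'.map (V.map f.right)) (by
    rw [Category.assoc, ← U'.map_comp, ← f.w, U'.map_comp]
    exact adj.unit_naturality_assoc f.left _)

theorem comp_unit_comp_map_eq_zero_iff {X' X : A} {Y : C} (f : X' ⟶ X) (θ : U.obj X ⟶ Y) :
    f ≫ adj.unit.app X ≫ U'.map θ = 0 ↔ U.map f ≫ θ = 0 := by
  have : U'.IsRightAdjoint := adj.isRightAdjoint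
  have h : adj.homEquiv X' Y (U.map f ≫ θ) = f ≫ adj.unit.app X ≫ U'.map θ := by
    simp [Adjunction.homEquiv_unit]
  have h0 : adj.homEquiv X' Y 0 = 0 := by
    simp [Adjunction.homEquiv_unit]
  rw [← h, ← h0, (adj.homEquiv X' Y).apply_eq_iff_eq]

variable [U.Additive] [V.Additive]

/-- The stalk functor `S_A` is left adjoint to `K_A`. -/
noncomputable def stalkLeftAdjunction : stalkLeft U V ⊣ kernelFunctor V adj :=
  Adjunction.mkOfHomEquiv
    { homEquiv _ Z :=
        { toFun f := kernel.lift _ f.left <|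
            (comp_unit_comp_map_eq_zero_iff adj _ _).2 (f.w.trans zero_comp)
          invFun g :=
            { left := g ≫ kernel.ι (adj.unit.app Z.left ≫ U'.map Z.hom)
              right := (isZero_zero B).to_ Z.right
              w := ((comp_unit_comp_map_eq_zero_iff adj _ _).1 ((Category.assoc _ _ _).trans
                ((congrArg (g ≫ ·) (kernel.condition _)).trans comp_zero))).trans
                  zero_comp.symm }
          left_inv _ := Comma.hom_ext _ _ (kernel.lift_ι _ _ _) ((isZero_zero B).eq_of_src _ _)
          right_inv _ := equalizer.hom_ext (kernel.lift_ι _ _ _) }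
      homEquiv_naturality_left_symm _ _ :=
        Comma.hom_ext _ _ (Category.assoc _ _ _) ((isZero_zero B).eq_of_src _ _)
      homEquiv_naturality_right _ _ := equalizer.hom_ext <|
        (kernel.lift_ι _ _ _).trans (Eq.symm <| (Category.assoc _ _ _).trans <|
          (congrArg (_ ≫ ·) (kernel.lift_ι _ _ _)).trans <|
          (Category.assoc _ _ _).symm.trans (congrArg (· ≫ _) (kernel.lift_ι _ _ _))) }

theorem isZero_of_isZero_left_right {Z : Comma U V} (hl : IsZero Z.left) (hr : IsZero Z.right) :
    IsZero Z where
  unique_to W :=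
    ⟨{  default :=
          { left := hl.to_ W.left
            right := hr.to_ W.right
            w := (U.map_isZero hl).eq_of_src _ _ }
        uniq _ := Comma.hom_ext _ _ (hl.eq_of_src _ _) (hr.eq_of_src _ _) }⟩
  unique_from W :=
    ⟨{  default :=
          { left := hl.from_ W.left
            right := hr.from_ W.right
            w := (V.map_isZero hr).eq_of_tgt _ _ }
        uniq _ := Comma.hom_ext _ _ (hl.eq_of_tgt _ _) (hr.eq_of_tgt _ _) }⟩

theorem isZero_of_isZero_kernelFunctor_obj {Z : Comma U V}
    (hK : IsZero ((kernelFunctor V adj).obj Z)) (hr : IsZero Z.right) : IsZero Z := by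
  refine isZero_of_isZero_left_right V ?_ hr
  have h : 𝟙 Z.left ≫ adj.unit.app Z.left ≫ U'.map Z.hom = 0 :=
    (comp_unit_comp_map_eq_zero_iff adj _ _).2 ((V.map_isZero hr).eq_of_tgt _ _)
  rw [IsZero.iff_id_eq_zero, ← kernel.lift_ι _ _ h]
  exact (congrArg (· ≫ kernel.ι _) (hK.eq_of_tgt _ 0)).trans zero_comp

/-- The stalk functor `S_B` is left adjoint to the projection `(X, Y, θ) ↦ Y`. -/
noncomputable def stalkRightAdjunction (U : A ⥤ C) [U.Additive] : stalkRight U V ⊣ Comma.snd U V :=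
  Adjunction.mkOfHomEquiv
    { homEquiv _ Z :=
        { toFun f := f.right
          invFun g :=
            { left := (isZero_zero A).to_ Z.left
              right := g
              w := (U.map_isZero (isZero_zero A)).eq_of_src _ _ }
          left_inv _ := Comma.hom_ext _ _ ((isZero_zero A).eq_of_src _ _) rfl
          right_inv _ := rfl }
      homEquiv_naturality_left_symm _ _ :=
        Comma.hom_ext _ _ ((isZero_zero A).eq_of_src _ _) rfl
      homEquiv_naturality_right _ _ := rfl }

end CommaAbelian

/-- **Lemma 5.3.** Let `A, B, C` be abelian categories, `U : A ⥤ C` right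
exact and `V : B ⥤ C` left exact (both additive), and consider the comma category `(U ↓ V)`
with its stalk functors `S_A` and `S_B`.  (a) `S_B` has right adjoint
`K_B : (U ↓ V) ⥤ B`, `(X,Y,θ) ↦ Y` (the second projection).  (b) If `U` has a right adjoint
`U^!` with unit `η`, then `S_A` has a right adjoint `K_A` given by
`(X,Y,θ) ↦ Ker (U^!θ ∘ η_X)`.  In particular, if `K_A (X,Y,θ) = 0` and `K_B (X,Y,θ) = 0`,
then `(X,Y,θ) = 0`. -/
theorem comma_stalk_functors_have_right_adjoints
    {A B C : Type*} [Category A] [Category B] [Category C]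
    [Abelian A] [Abelian B] [Abelian C]
    (U : A ⥤ C) (V : B ⥤ C) [U.Additive] [V.Additive]
    (hU : Nonempty (PreservesFiniteColimits U)) (hV : Nonempty (PreservesFiniteLimits V)) :
    Nonempty (stalkRight U V ⊣ Comma.snd U V) ∧
    (∀ (U' : C ⥤ A) (adjU : U ⊣ U'),
      ∃ KA : Comma U V ⥤ A,
        (∀ Z : Comma U V, KA.obj Z = kernel (adjU.unit.app Z.left ≫ U'.map Z.hom)) ∧
        Nonempty (stalkLeft U V ⊣ KA) ∧
        (∀ Z : Comma U V,
          IsZero (KA.obj Z) → IsZero ((Comma.snd U V).obj Z) → IsZero Z)) := by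
  refine ⟨⟨stalkRightAdjunction V U⟩, fun U' adjU => ⟨kernelFunctor V adjU, fun _ => rfl,
    ⟨stalkLeftAdjunction V adjU⟩, fun _ => isZero_of_isZero_kernelFunctor_obj V adjU⟩⟩
end
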